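/- arXiv:1304.5209 — 2 statements merged into one kernel-verified Lean document; each statement's English description precedes it below -/
import Mathlib

section
/- Let 0 < d < 1/2 and let L be slowly varying at infinity. Set a_i = i^{d-1} L(i) for integers i ≥ 1. Then, as n → ∞, (1 / (L(n)^2 n^{2d-1})) · ∑_{i=1}^∞ a_{n+i} a_i → ∫_0^∞ u^{d-1}(1+u)^{d-1} du = B(d, 1-2d), where B denotes the Beta function. In particular the series ∑_{i=1}^∞ a_{n+i} a_i is finite for every n ≥ 1. -/
open Filter Topology

/-- A measurable function `L : ℝ → ℝ` is slowly varying at infinity if it is eventually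
positive and `L (l * x) / L x → 1` as `x → ∞` for every `l > 0`. -/
def SlowlyVaryingAtTop (L : ℝ → ℝ) : Prop :=
  Measurable L ∧ (∀ᶠ x in atTop, 0 < L x) ∧
    ∀ l : ℝ, 0 < l → Tendsto (fun x => L (l * x) / L x) atTop (𝓝 1)

theorem min_one_abs_le_add (s t : ℝ) : min 1 |s| ≤ min 1 |t| + min 1 |s - t| := by
  have h : |s| ≤ |t| + |s - t| := by
    have := abs_add_le t (s - t); simpa using this
  have h1 := abs_nonneg t
  have h2 := abs_nonneg (s - t)
  rcases min_cases 1 |t| with ⟨e1, _⟩ | ⟨e1, _⟩ <;>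
  rcases min_cases 1 |s - t| with ⟨e2, _⟩ | ⟨e2, _⟩ <;>
  rw [e1, e2] <;> rcases min_cases 1 |s| with ⟨e3, _⟩ | ⟨e3, _⟩ <;> rw [e3] <;> linarith

theorem intervalIntegrable_min_one_abs {f : ℝ → ℝ} (hf : Measurable f) (a b : ℝ) :
    IntervalIntegrable (fun y => min 1 |f y|) MeasureTheory.volume a b := by
  refine (intervalIntegrable_const (c := (1 : ℝ))).mono_fun
    (by fun_prop) (Eventually.of_forall fun y => ?_)
  have : 0 ≤ min 1 |f y| := le_min zero_le_one (abs_nonneg _)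
  simp [abs_of_nonneg this]

/-- The uniform convergence theorem, in additive form, on increments of length at most one. -/
theorem exists_forall_abs_sub_le {h : ℝ → ℝ} (hm : Measurable h)
    (hv : ∀ v, Tendsto (fun x => h (x + v) - h x) atTop (𝓝 0)) {ε : ℝ} (hε : 0 < ε) :
    ∃ X, ∀ x, X ≤ x → ∀ v, 0 ≤ v → v ≤ 1 → |h (x + v) - h x| ≤ ε := by
  set g : ℝ → ℝ := fun x => ∫ y in (0 : ℝ)..2, min 1 |h (x + y) - h x| with hg
  have hint : ∀ x a b, IntervalIntegrable (fun y => min 1 |h (x + y) - h x|)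
      MeasureTheory.volume a b := fun x a b =>
    intervalIntegrable_min_one_abs (by fun_prop) a b
  have hnn : ∀ t : ℝ, 0 ≤ min 1 |t| := fun t => le_min zero_le_one (abs_nonneg _)
  have hlim : Tendsto g atTop (𝓝 0) := by
    have : Tendsto g atTop (𝓝 (∫ y in (0 : ℝ)..2, (0 : ℝ))) := by
      refine intervalIntegral.tendsto_integral_filter_of_dominated_convergence (fun _ => 1)
        (Eventually.of_forall fun x => ?_) (Eventually.of_forall fun x => ?_) (by simp) ?_
      · exact Measurable.aestronglyMeasurable (by fun_prop)
      · refine Eventually.of_forall fun y _ => ?_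
        simp [abs_of_nonneg (hnn _)]
      · refine Eventually.of_forall fun y _ => ?_
        have := (tendsto_const_nhds (x := (1 : ℝ))).min (hv y).abs
        simpa using this
    simpa using this
  obtain ⟨X, hX⟩ := eventually_atTop.1
    (hlim.eventually (gt_mem_nhds (show (0 : ℝ) < min 1 ε / 2 by positivity)))
  refine ⟨X, fun x hx v hv0 hv1 => ?_⟩
  have h1 : ∫ y in (1 : ℝ)..2, min 1 |h (x + v) - h x| ≤
      ∫ y in (1 : ℝ)..2, (min 1 |h (x + y) - h x| + min 1 |h (x + y) - h (x + v)|) := by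
    refine intervalIntegral.integral_mono_on (by norm_num) (by simp)
      ((hint x 1 2).add (intervalIntegrable_min_one_abs (by fun_prop) 1 2)) fun y _ => ?_
    have := min_one_abs_le_add (h (x + v) - h x) (h (x + y) - h x)
    rwa [sub_sub_sub_cancel_right, abs_sub_comm (h (x + v)) (h (x + y))] at this
  rw [intervalIntegral.integral_add (hint x 1 2)
    (intervalIntegrable_min_one_abs (by fun_prop) 1 2)] at h1
  have h2 : ∫ y in (1 : ℝ)..2, min 1 |h (x + y) - h x| ≤ g x :=
    intervalIntegral.integral_mono_interval (by norm_num) (by norm_num) le_rfl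
      (Eventually.of_forall fun _ => hnn _) (hint x 0 2)
  have h3 : ∫ y in (1 : ℝ)..2, min 1 |h (x + y) - h (x + v)| ≤ g (x + v) := by
    have e := intervalIntegral.integral_comp_sub_right
      (fun y => min 1 |h (x + v + y) - h (x + v)|) (a := 1) (b := 2) v
    have e' : ∀ y, x + v + (y - v) = x + y := fun y => by ring
    simp only [e'] at e
    rw [e]
    exact intervalIntegral.integral_mono_interval (by linarith) (by linarith) (by linarith)
      (Eventually.of_forall fun _ => hnn _) (hint (x + v) 0 2)
  have h4 := hX x hx
  have h5 := hX (x + v) (by linarith)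
  have h6 : min 1 |h (x + v) - h x| < min 1 ε := by
    have : ∫ y in (1 : ℝ)..2, min 1 |h (x + v) - h x| = min 1 |h (x + v) - h x| := by
      rw [intervalIntegral.integral_const]; norm_num
    linarith
  rcases min_lt_iff.1 h6 with h7 | h7
  · exact absurd (h7.trans_le (min_le_left _ _)) (lt_irrefl _)
  · exact (h7.trans_le (min_le_right _ _)).le

theorem exists_forall_abs_sub_le_mul {h : ℝ → ℝ} (hm : Measurable h)
    (hv : ∀ v, Tendsto (fun x => h (x + v) - h x) atTop (𝓝 0)) {ε : ℝ} (hε : 0 < ε) :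
    ∃ X, ∀ x, X ≤ x → ∀ y, X ≤ y → |h y - h x| ≤ ε * (|y - x| + 1) := by
  obtain ⟨X, hX⟩ := exists_forall_abs_sub_le hm hv hε
  have key : ∀ k : ℕ, ∀ x, X ≤ x → ∀ v : ℝ, 0 ≤ v → v ≤ k + 1 →
      |h (x + v) - h x| ≤ ε * (v + 1) := by
    intro k
    induction k with
    | zero =>
      intro x hx v h0 h1
      have := hX x hx v h0 (by simpa using h1)
      nlinarith
    | succ k ih =>
      intro x hx v h0 h1
      rcases le_total v 1 with hv1 | hv1
      · have := hX x hx v h0 hv1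
        nlinarith
      · have e1 := hX x hx 1 zero_le_one le_rfl
        have e2 := ih (x + 1) (by linarith) (v - 1) (by linarith) (by push_cast at h1; linarith)
        rw [add_add_sub_cancel, sub_add_cancel] at e2
        have e3 := abs_add_le (h (x + v) - h (x + 1)) (h (x + 1) - h x)
        rw [sub_add_sub_cancel] at e3
        linarith
  have key' : ∀ x, X ≤ x → ∀ y, x ≤ y → |h y - h x| ≤ ε * (|y - x| + 1) := by
    intro x hx y hy
    obtain ⟨k, hk⟩ := exists_nat_ge (y - x)
    have := key k x hx (y - x) (by linarith) (by linarith)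
    rwa [add_sub_cancel, ← abs_of_nonneg (sub_nonneg.2 hy)] at this
  refine ⟨X, fun x hx y hy => ?_⟩
  rcases le_total x y with hxy | hxy
  · exact key' x hx y hxy
  · rw [abs_sub_comm, abs_sub_comm y]
    exact key' y hy x hxy

theorem tendsto_sub_of_tendsto_sub {ι : Type*} {l : Filter ι} {h : ℝ → ℝ} (hm : Measurable h)
    (hv : ∀ v, Tendsto (fun x => h (x + v) - h x) atTop (𝓝 0)) {x y : ι → ℝ} {v : ℝ}
    (hx : Tendsto x l atTop) (hxy : Tendsto (fun i => y i - x i) l (𝓝 v)) :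
    Tendsto (fun i => h (y i) - h (x i)) l (𝓝 0) := by
  have hxv : Tendsto (fun i => x i + v) l atTop := tendsto_atTop_add_const_right _ _ hx
  have hy : Tendsto y l atTop := by
    simpa using hx.atTop_add hxy
  have h1 : Tendsto (fun i => h (y i) - h (x i + v)) l (𝓝 0) := by
    rw [Metric.tendsto_nhds]
    intro ε hε
    obtain ⟨X, hX⟩ := exists_forall_abs_sub_le_mul hm hv (show 0 < ε / 3 by positivity)
    filter_upwards [hxv.eventually_ge_atTop X, hy.eventually_ge_atTop X,
      Metric.tendsto_nhds.1 hxy 1 one_pos] with i h1 h2 h3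
    have := hX _ h1 _ h2
    rw [Real.dist_eq, sub_sub] at h3
    rw [Real.dist_eq, sub_zero]
    nlinarith
  simpa using h1.add ((hv v).comp hx)

theorem integral_Ioi_rpow_mul_one_add_rpow {d : ℝ} (hd0 : 0 < d) (hd2 : d < 1 / 2) :
    ∫ u in Set.Ioi (0 : ℝ), u ^ (d - 1) * (1 + u) ^ (d - 1) =
      Real.Gamma d * Real.Gamma (1 - 2 * d) / Real.Gamma (1 - d) := by
  have himg : (fun x : ℝ => x / (1 - x)) '' Set.Ioo 0 1 = Set.Ioi 0 := by
    ext u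
    simp only [Set.mem_image, Set.mem_Ioo, Set.mem_Ioi]
    constructor
    · rintro ⟨x, ⟨h0, h1⟩, rfl⟩
      exact div_pos h0 (by linarith)
    · intro hu
      refine ⟨u / (1 + u), ⟨by positivity, ?_⟩, ?_⟩
      · rw [div_lt_one (by positivity)]; linarith
      · field_simp; ring
  have hder : ∀ x ∈ Set.Ioo (0 : ℝ) 1,
      HasDerivWithinAt (fun x : ℝ => x / (1 - x)) (1 / (1 - x) ^ 2) (Set.Ioo 0 1) x := by
    intro x hx
    have h := (hasDerivAt_id x).div ((hasDerivAt_id x).const_sub 1)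
      (show (1 : ℝ) - x ≠ 0 by linarith [hx.2])
    exact h.hasDerivWithinAt.congr_deriv (by simp)
  have hinj : Set.InjOn (fun x : ℝ => x / (1 - x)) (Set.Ioo 0 1) := by
    intro x hx y hy hxy
    have h1 : (1 : ℝ) - x ≠ 0 := by linarith [hx.2]
    have h2 : (1 : ℝ) - y ≠ 0 := by linarith [hy.2]
    simp only at hxy
    rw [div_eq_div_iff h1 h2] at hxy
    linarith
  have hbeta : ∫ x in Set.Ioo (0 : ℝ) 1, x ^ (d - 1) * (1 - x) ^ (1 - 2 * d - 1) =
      ProbabilityTheory.beta d (1 - 2 * d) := by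
    rw [ProbabilityTheory.beta_eq_betaIntegralReal d (1 - 2 * d) hd0 (by linarith),
      Complex.betaIntegral, ← MeasureTheory.integral_Ioc_eq_integral_Ioo,
      ← intervalIntegral.integral_of_le zero_le_one, ← Complex.ofReal_re
        (∫ x in (0 : ℝ)..1, x ^ (d - 1) * (1 - x) ^ (1 - 2 * d - 1)),
      ← intervalIntegral.integral_ofReal]
    congr 1
    refine intervalIntegral.integral_congr fun x hx => ?_
    rw [Set.uIcc_of_le zero_le_one] at hx
    rw [Complex.ofReal_mul, Complex.ofReal_cpow hx.1, Complex.ofReal_cpow (sub_nonneg.2 hx.2)]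
    push_cast
    rfl
  rw [← himg, MeasureTheory.integral_image_eq_integral_abs_deriv_smul measurableSet_Ioo hder hinj,
    show Real.Gamma (1 - d) = Real.Gamma (d + (1 - 2 * d)) by ring_nf]
  refine Eq.trans ?_ hbeta
  refine MeasureTheory.setIntegral_congr_fun measurableSet_Ioo fun x hx => ?_
  have h1 : (0 : ℝ) < 1 - x := by linarith [hx.2]
  have e1 : 1 + x / (1 - x) = (1 - x)⁻¹ := by field_simp; ring
  have e2 : (1 - x) ^ (1 - 2 * d - 1) =
      ((1 - x) ^ (d - 1))⁻¹ * ((1 - x) ^ (d - 1))⁻¹ * ((1 - x) ^ 2)⁻¹ := by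
    rw [← Real.rpow_natCast (1 - x) 2, ← Real.rpow_neg h1.le, ← Real.rpow_neg h1.le,
      ← Real.rpow_add h1, ← Real.rpow_add h1]
    congr 1
    push_cast
    ring
  simp only [smul_eq_mul]
  rw [e1, e2, Real.div_rpow hx.1.le h1.le, Real.inv_rpow h1.le, abs_of_pos (by positivity)]
  ring

theorem integrableOn_Ioi_rpow_mul_one_add_rpow {p q : ℝ} (hp : -1 < p) (hq : q ≤ 0)
    (hpq : p + q < -1) :
    MeasureTheory.IntegrableOn (fun u : ℝ => u ^ p * (1 + u) ^ q) (Set.Ioi 0) := by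
  rw [← Set.Ioc_union_Ioi_eq_Ioi zero_le_one]
  refine MeasureTheory.IntegrableOn.union ?_ ?_
  · refine MeasureTheory.Integrable.mono'
      ((intervalIntegrable_iff_integrableOn_Ioc_of_le zero_le_one).1
        (intervalIntegral.intervalIntegrable_rpow' hp))
      (Measurable.aestronglyMeasurable (by fun_prop)) ?_
    filter_upwards [MeasureTheory.ae_restrict_mem measurableSet_Ioc] with u hu
    have h0 : 0 < u := hu.1
    rw [Real.norm_of_nonneg (by positivity)]
    exact mul_le_of_le_one_right (by positivity)
      (Real.rpow_le_one_of_one_le_of_nonpos (by linarith) hq)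
  · refine MeasureTheory.Integrable.mono' (integrableOn_Ioi_rpow_of_lt hpq one_pos)
      (Measurable.aestronglyMeasurable (by fun_prop)) ?_
    filter_upwards [MeasureTheory.ae_restrict_mem measurableSet_Ioi] with u hu
    have h0 : 0 < u := one_pos.trans hu
    rw [Real.norm_of_nonneg (by positivity), Real.rpow_add h0]
    exact mul_le_mul_of_nonneg_left
      (Real.rpow_le_rpow_of_nonpos h0 (by linarith) hq) (by positivity)

theorem map_natFloor_volume_restrict_Ioi :
    MeasureTheory.Measure.map (fun x : ℝ => ⌊x⌋₊)
      (MeasureTheory.volume.restrict (Set.Ioi 0)) = MeasureTheory.Measure.count := by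
  refine MeasureTheory.Measure.ext_of_singleton fun k => ?_
  rw [MeasureTheory.Measure.restrict_congr_set MeasureTheory.Ioi_ae_eq_Ici,
    MeasureTheory.Measure.map_apply Nat.measurable_floor (measurableSet_singleton k),
    MeasureTheory.Measure.restrict_apply (Nat.measurable_floor (measurableSet_singleton k)),
    MeasureTheory.Measure.count_singleton]
  have : (fun x : ℝ => ⌊x⌋₊) ⁻¹' {k} ∩ Set.Ici 0 = Set.Ico (k : ℝ) (k + 1) := by
    ext x
    simp only [Set.mem_inter_iff, Set.mem_preimage, Set.mem_singleton_iff, Set.mem_Ici,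
      Set.mem_Ico]
    constructor
    · rintro ⟨h, hx⟩
      exact (Nat.floor_eq_iff hx).1 h
    · rintro h
      have hx : 0 ≤ x := k.cast_nonneg.trans h.1
      exact ⟨(Nat.floor_eq_iff hx).2 h, hx⟩
  rw [this]
  simp

theorem integral_Ioi_comp_natFloor_mul {f : ℕ → ℝ} (hf : Summable f) {c : ℝ} (hc : 0 < c) :
    ∫ u in Set.Ioi (0 : ℝ), f ⌊c * u⌋₊ = c⁻¹ * ∑' i, f i := by
  rw [MeasureTheory.integral_comp_mul_left_Ioi (fun x => f ⌊x⌋₊) 0 hc, mul_zero, smul_eq_mul,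
    ← MeasureTheory.integral_map (φ := fun x : ℝ => ⌊x⌋₊) (f := f)
      Nat.measurable_floor.aemeasurable
      (Measurable.aestronglyMeasurable (measurable_from_top)),
    map_natFloor_volume_restrict_Ioi, MeasureTheory.integral_countable]
  · simp
  · rw [MeasureTheory.integrable_count_iff]
    exact hf.norm

theorem tendsto_log_comp_exp_sub {L : ℝ → ℝ} (hL : SlowlyVaryingAtTop L) (v : ℝ) :
    Tendsto (fun x => Real.log (L (Real.exp (x + v))) - Real.log (L (Real.exp x)))
      atTop (𝓝 0) := by
  obtain ⟨-, hpos, hlim⟩ := hL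
  have h1 := ((hlim (Real.exp v) (Real.exp_pos v)).comp Real.tendsto_exp_atTop).log one_ne_zero
  rw [Real.log_one] at h1
  have hv : Tendsto (fun x => Real.exp (x + v)) atTop atTop :=
    Real.tendsto_exp_atTop.comp (tendsto_atTop_add_const_right _ _ tendsto_id)
  refine h1.congr' ?_
  filter_upwards [Real.tendsto_exp_atTop.eventually hpos, hv.eventually hpos] with x hx hxv
  rw [Function.comp_apply, ← Real.exp_add, add_comm v x, Real.log_div hxv.ne' hx.ne']

theorem exp_mul_abs_log_le {t δ : ℝ} (ht : 0 < t) :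
    Real.exp (δ * |Real.log t|) ≤ t ^ δ + t ^ (-δ) := by
  rw [Real.rpow_def_of_pos ht, Real.rpow_def_of_pos ht]
  rcases abs_choice (Real.log t) with h | h <;> rw [h]
  · rw [mul_comm]
    exact le_add_of_nonneg_right (Real.exp_pos _).le
  · rw [mul_neg, mul_neg, mul_comm]
    exact le_add_of_nonneg_left (Real.exp_pos _).le

/-- Potter's bound: the ratio `L i / L n` is at most a constant times
`max ((i / n) ^ δ) ((i / n) ^ (-δ))`, for all large `n` and all `i ≥ 1`. -/
theorem exists_potter_bound {L : ℝ → ℝ} (hL : SlowlyVaryingAtTop L) {δ : ℝ} (hδ : 0 < δ) :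
    ∃ C > 0, ∃ N : ℕ, 0 < N ∧ ∀ n : ℕ, N ≤ n → 0 < L n ∧ ∀ i : ℕ, 1 ≤ i →
      |L i| ≤ C * L n * (((i : ℝ) / n) ^ δ + ((i : ℝ) / n) ^ (-δ)) := by
  obtain ⟨X, hX⟩ := exists_forall_abs_sub_le_mul
    (h := fun x => Real.log (L (Real.exp x)))
    (Real.measurable_log.comp (hL.1.comp Real.measurable_exp)) (tendsto_log_comp_exp_sub hL) hδ
  have hcast := tendsto_natCast_atTop_atTop (R := ℝ)
  obtain ⟨N₀, hN₀⟩ := eventually_atTop.1 ((hcast.eventually hL.2.1).and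
    ((Real.tendsto_log_atTop.comp hcast).eventually_ge_atTop X))
  set N := max N₀ 1 with hN
  have hNpos : 0 < N := lt_max_of_lt_right one_pos
  have hbig : ∀ n : ℕ, N ≤ n → (0 : ℝ) < n ∧ 0 < L n ∧ X ≤ Real.log n := fun n hn =>
    ⟨by exact_mod_cast hNpos.trans_le hn, hN₀ n ((le_max_left _ _).trans hn)⟩
  have key : ∀ n : ℕ, N ≤ n → ∀ i : ℕ, N ≤ i →
      L i ≤ Real.exp δ * L n * (((i : ℝ) / n) ^ δ + ((i : ℝ) / n) ^ (-δ)) := by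
    intro n hn i hi
    obtain ⟨n0, Ln0, Xn⟩ := hbig n hn
    obtain ⟨i0, Li0, Xi⟩ := hbig i hi
    have h1 := (le_abs_self _).trans (hX _ Xn _ Xi)
    simp only [Real.exp_log n0, Real.exp_log i0] at h1
    rw [← Real.log_div i0.ne' n0.ne'] at h1
    have h2 : L i ≤ Real.exp (Real.log (L n) + δ + δ * |Real.log (i / n)|) := by
      rw [← Real.log_le_iff_le_exp Li0]
      linarith
    rw [Real.exp_add, Real.exp_add, Real.exp_log Ln0, mul_comm (L n)] at h2
    exact h2.trans (mul_le_mul_of_nonneg_left (exp_mul_abs_log_le (by positivity))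
      (by positivity))
  set M := ∑ j ∈ Finset.range N, |L j| with hM
  have hM0 : 0 ≤ M := Finset.sum_nonneg fun _ _ => abs_nonneg _
  have hLN : 0 < L N := (hbig N le_rfl).2.1
  refine ⟨Real.exp δ + M / L N * (2 * Real.exp δ), by positivity, N, hNpos, fun n hn => ?_⟩
  obtain ⟨n0, Ln0, -⟩ := hbig n hn
  refine ⟨Ln0, fun i hi => ?_⟩
  have i0 : (0 : ℝ) < i := by exact_mod_cast hi
  rcases le_or_gt N i with hNi | hNi
  · rw [abs_of_pos (hbig i hNi).2.1]
    refine (key n hn i hNi).trans ?_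
    gcongr
    exact le_add_of_nonneg_right (by positivity)
  · have h1 : |L i| ≤ M :=
      Finset.single_le_sum (f := fun j : ℕ => |L j|) (fun _ _ => abs_nonneg _)
        (Finset.mem_range.2 hNi)
    have N0 : (0 : ℝ) < N := (hbig N le_rfl).1
    have hNn : (N : ℝ) / n ≤ 1 := (div_le_one n0).2 (by exact_mod_cast hn)
    have h2 : ((N : ℝ) / n) ^ δ ≤ ((N : ℝ) / n) ^ (-δ) :=
      Real.rpow_le_rpow_of_exponent_ge (by positivity) hNn (by linarith)
    have h3 : ((N : ℝ) / n) ^ (-δ) ≤ ((i : ℝ) / n) ^ (-δ) :=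
      Real.rpow_le_rpow_of_nonpos (by positivity) (by gcongr) (by linarith)
    have h4 : L N ≤ 2 * Real.exp δ * L n * ((i : ℝ) / n) ^ (-δ) := by
      have := mul_le_mul_of_nonneg_left (show ((N : ℝ) / n) ^ δ + ((N : ℝ) / n) ^ (-δ) ≤
        2 * ((i : ℝ) / n) ^ (-δ) by linarith) (show 0 ≤ Real.exp δ * L n by positivity)
      linarith [key n hn N le_rfl]
    calc |L i| ≤ M := h1
      _ = M / L N * L N := (div_mul_cancel₀ _ hLN.ne').symm
      _ ≤ M / L N * (2 * Real.exp δ * L n * ((i : ℝ) / n) ^ (-δ)) := by gcongr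
      _ = M / L N * (2 * Real.exp δ) * L n * ((i : ℝ) / n) ^ (-δ) := by ring
      _ ≤ _ := by
        gcongr
        · exact le_add_of_nonneg_left (by positivity)
        · exact le_add_of_nonneg_left (by positivity)

theorem tendsto_slowlyVarying_ratio {L : ℝ → ℝ} (hL : SlowlyVaryingAtTop L) {k : ℕ → ℕ} {u : ℝ}
    (hu : 0 < u) (hk : Tendsto (fun n => (k n : ℝ) / n) atTop (𝓝 u)) :
    Tendsto (fun n : ℕ => L (k n) / L n) atTop (𝓝 1) := by
  have hn : Tendsto (fun n : ℕ => (n : ℝ)) atTop atTop := tendsto_natCast_atTop_atTop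
  have hn0 := hn.eventually_gt_atTop 0
  have hk' : Tendsto (fun n => (k n : ℝ)) atTop atTop := by
    refine (hk.pos_mul_atTop hu hn).congr' ?_
    filter_upwards [hn0] with n h
    exact div_mul_cancel₀ _ h.ne'
  have hk0 := hk'.eventually_gt_atTop 0
  have h1 : Tendsto (fun n : ℕ => Real.log (k n) - Real.log n) atTop (𝓝 (Real.log u)) := by
    refine (hk.log hu.ne').congr' ?_
    filter_upwards [hn0, hk0] with n h h'
    exact Real.log_div h'.ne' h.ne'
  have h2 := (tendsto_sub_of_tendsto_sub
    (h := fun x => Real.log (L (Real.exp x)))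
    (Real.measurable_log.comp (hL.1.comp Real.measurable_exp)) (tendsto_log_comp_exp_sub hL)
    (Real.tendsto_log_atTop.comp hn) h1).rexp
  rw [Real.exp_zero] at h2
  refine h2.congr' ?_
  filter_upwards [hn0, hk0, hn.eventually hL.2.1, hk'.eventually hL.2.1] with n h h' hl hl'
  simp only [Function.comp_apply]
  rw [Real.exp_log h, Real.exp_log h', Real.exp_sub, Real.exp_log hl, Real.exp_log hl']

theorem tendsto_rescaled_coeff {L : ℝ → ℝ} (hL : SlowlyVaryingAtTop L) (p : ℝ) {k : ℕ → ℕ}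
    {u : ℝ} (hu : 0 < u) (hk : Tendsto (fun n => (k n : ℝ) / n) atTop (𝓝 u)) :
    Tendsto (fun n : ℕ => ((k n : ℝ) / n) ^ p * (L (k n) / L n)) atTop (𝓝 (u ^ p)) := by
  simpa using (hk.rpow_const (Or.inl hu.ne')).mul (tendsto_slowlyVarying_ratio hL hu hk)

theorem summable_shifted_mul_self {L : ℝ → ℝ} (hL : SlowlyVaryingAtTop L) {d : ℝ}
    (hd2 : d < 1 / 2) {a : ℕ → ℝ} (ha : ∀ i : ℕ, 1 ≤ i → a i = (i : ℝ) ^ (d - 1) * L i) (n : ℕ) :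
    Summable fun i : ℕ => a (n + (i + 1)) * a (i + 1) := by
  obtain ⟨δ, hδ, hdδ⟩ : ∃ δ : ℝ, 0 < δ ∧ d + δ < 1 / 2 :=
    ⟨(1 / 2 - d) / 2, by linarith, by linarith⟩
  obtain ⟨C, hC, N, hN, hP⟩ := exists_potter_bound hL hδ
  obtain ⟨hLN, hP⟩ := hP N le_rfl
  have hN0 : (0 : ℝ) < N := by exact_mod_cast hN
  set K := C * L N * (((N : ℝ) ^ δ)⁻¹ + ((N : ℝ) ^ (-δ))⁻¹) with hK
  have hK0 : 0 ≤ K := by positivity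
  have hbound : ∀ i : ℕ, 1 ≤ i → |a i| ≤ K * (i : ℝ) ^ (d - 1 + δ) := by
    intro i hi
    have i1 : (1 : ℝ) ≤ i := by exact_mod_cast hi
    have i0 : (0 : ℝ) < i := by linarith
    have h1 : (i : ℝ) ^ (-δ) ≤ (i : ℝ) ^ δ := Real.rpow_le_rpow_of_exponent_le i1 (by linarith)
    have h2 : |L i| ≤ K * (i : ℝ) ^ δ := by
      refine (hP i hi).trans ?_
      rw [Real.div_rpow i0.le hN0.le, Real.div_rpow i0.le hN0.le, hK, mul_assoc (C * L N), add_mul,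
        div_eq_inv_mul, div_eq_inv_mul]
      gcongr
    rw [ha i hi, abs_mul, abs_of_pos (by positivity), Real.rpow_add i0]
    calc (i : ℝ) ^ (d - 1) * |L i| ≤ (i : ℝ) ^ (d - 1) * (K * (i : ℝ) ^ δ) := by gcongr
      _ = _ := by ring
  have hsum : Summable fun i : ℕ => K ^ 2 * ((i + 1 : ℕ) : ℝ) ^ (2 * (d - 1 + δ)) :=
    ((summable_nat_add_iff (f := fun i : ℕ => (i : ℝ) ^ (2 * (d - 1 + δ))) 1).2
      (Real.summable_nat_rpow.2 (by linarith))).mul_left _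
  refine Summable.of_norm_bounded hsum fun i => ?_
  have i0 : (0 : ℝ) < ((i + 1 : ℕ) : ℝ) := by positivity
  have h1 : ((n + (i + 1) : ℕ) : ℝ) ^ (d - 1 + δ) ≤ ((i + 1 : ℕ) : ℝ) ^ (d - 1 + δ) :=
    Real.rpow_le_rpow_of_nonpos i0 (by exact_mod_cast Nat.le_add_left _ _) (by linarith)
  rw [Real.norm_eq_abs, abs_mul]
  calc |a (n + (i + 1))| * |a (i + 1)|
      ≤ (K * ((i + 1 : ℕ) : ℝ) ^ (d - 1 + δ)) * (K * ((i + 1 : ℕ) : ℝ) ^ (d - 1 + δ)) := by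
        gcongr
        · exact (hbound _ (by omega)).trans (by gcongr)
        · exact hbound _ (by omega)
    _ = _ := by rw [two_mul, Real.rpow_add i0 (d - 1 + δ) (d - 1 + δ)]; ring

theorem tendsto_integral_rescaled_coeff {L : ℝ → ℝ} (hL : SlowlyVaryingAtTop L) {d : ℝ}
    (hd0 : 0 < d) (hd2 : d < 1 / 2) {b : ℕ → ℕ → ℝ}
    (hb : ∀ n i : ℕ, b n i = ((i : ℝ) / n) ^ (d - 1) * (L i / L n)) :
    Tendsto (fun n : ℕ => ∫ u in Set.Ioi (0 : ℝ),
        b n (n + (⌊(n : ℝ) * u⌋₊ + 1)) * b n (⌊(n : ℝ) * u⌋₊ + 1)) atTop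
      (𝓝 (∫ u in Set.Ioi (0 : ℝ), u ^ (d - 1) * (1 + u) ^ (d - 1))) := by
  obtain ⟨δ, hδ, hδd, hdδ⟩ : ∃ δ : ℝ, 0 < δ ∧ δ < d ∧ d + δ < 1 / 2 := by
    have h : 0 < min d (1 / 2 - d) := lt_min hd0 (by linarith)
    exact ⟨min d (1 / 2 - d) / 2, by linarith, by linarith [min_le_left d (1 / 2 - d)],
      by linarith [min_le_right d (1 / 2 - d)]⟩
  obtain ⟨C, hC, N, hN, hP⟩ := exists_potter_bound hL hδ
  have hbound : ∀ n : ℕ, N ≤ n → ∀ i : ℕ, 1 ≤ i →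
      |b n i| ≤ C * (((i : ℝ) / n) ^ (d - 1 + δ) + ((i : ℝ) / n) ^ (d - 1 - δ)) := by
    intro n hn i hi
    obtain ⟨Ln0, h⟩ := hP n hn
    have n0 : (0 : ℝ) < n := by exact_mod_cast hN.trans_le hn
    have i0 : (0 : ℝ) < i := by exact_mod_cast hi
    have t0 : (0 : ℝ) < (i : ℝ) / n := by positivity
    rw [hb, abs_mul, abs_div, abs_of_pos Ln0, abs_of_pos (by positivity), sub_eq_add_neg _ δ,
      Real.rpow_add t0, Real.rpow_add t0, ← mul_add, mul_left_comm]
    gcongr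
    rw [div_le_iff₀ Ln0]
    exact (h i hi).trans_eq (by ring)
  refine MeasureTheory.tendsto_integral_filter_of_dominated_convergence
    (fun u => 2 * C ^ 2 * (u ^ (d - 1 + δ) * (1 + u) ^ (d - 1 + δ) +
      u ^ (d - 1 - δ) * (1 + u) ^ (d - 1 + δ))) ?_ ?_ ?_ ?_
  · refine Eventually.of_forall fun n => Measurable.aestronglyMeasurable ?_
    exact (measurable_from_top (f := fun i : ℕ => b n (n + (i + 1)) * b n (i + 1))).comp
      (Nat.measurable_floor.comp (measurable_const_mul (n : ℝ)))
  · filter_upwards [eventually_ge_atTop N] with n hn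
    filter_upwards [MeasureTheory.ae_restrict_mem measurableSet_Ioi] with u (hu : 0 < u)
    have n0 : (0 : ℝ) < n := by exact_mod_cast hN.trans_le hn
    set i := ⌊(n : ℝ) * u⌋₊ + 1 with hi
    have hi1 : 1 ≤ i := by omega
    have hui : u ≤ (i : ℝ) / n := by
      rw [le_div_iff₀ n0, mul_comm, hi]
      push_cast
      exact (Nat.lt_floor_add_one _).le
    have hni : ((n + i : ℕ) : ℝ) / n = 1 + (i : ℝ) / n := by
      push_cast
      rw [add_div, div_self n0.ne']
    have h1 := hbound n hn i hi1
    have h2 := hbound n hn (n + i) (by omega)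
    rw [hni] at h2
    have ht0 : 0 ≤ (i : ℝ) / n := by positivity
    have h3 : (1 + (i : ℝ) / n) ^ (d - 1 - δ) ≤ (1 + (i : ℝ) / n) ^ (d - 1 + δ) :=
      Real.rpow_le_rpow_of_exponent_le (by linarith) (by linarith)
    have h4 : (1 + (i : ℝ) / n) ^ (d - 1 + δ) ≤ (1 + u) ^ (d - 1 + δ) :=
      Real.rpow_le_rpow_of_nonpos (by linarith) (by linarith) (by linarith)
    have h5 : ((i : ℝ) / n) ^ (d - 1 + δ) ≤ u ^ (d - 1 + δ) :=
      Real.rpow_le_rpow_of_nonpos hu hui (by linarith)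
    have h6 : ((i : ℝ) / n) ^ (d - 1 - δ) ≤ u ^ (d - 1 - δ) :=
      Real.rpow_le_rpow_of_nonpos hu hui (by linarith)
    rw [Real.norm_eq_abs, abs_mul]
    calc |b n (n + i)| * |b n i|
        ≤ (C * (2 * (1 + u) ^ (d - 1 + δ))) * (C * (u ^ (d - 1 + δ) + u ^ (d - 1 - δ))) := by
          gcongr
          · exact h2.trans (mul_le_mul_of_nonneg_left (by linarith) hC.le)
          · exact h1.trans (mul_le_mul_of_nonneg_left (by linarith) hC.le)
      _ = _ := by ring
  · exact ((integrableOn_Ioi_rpow_mul_one_add_rpow (by linarith) (by linarith)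
      (by linarith)).add (integrableOn_Ioi_rpow_mul_one_add_rpow (by linarith) (by linarith)
      (by linarith))).const_mul _
  · filter_upwards [MeasureTheory.ae_restrict_mem measurableSet_Ioi] with u (hu : 0 < u)
    have hn : Tendsto (fun n : ℕ => (n : ℝ)) atTop atTop := tendsto_natCast_atTop_atTop
    have hk : Tendsto (fun n : ℕ => ((⌊(n : ℝ) * u⌋₊ + 1 : ℕ) : ℝ) / n) atTop (𝓝 u) := by
      have h := ((tendsto_nat_floor_mul_div_atTop hu.le).comp hn).add
        (tendsto_inv_atTop_zero.comp hn)
      rw [add_zero] at h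
      refine h.congr fun n => ?_
      simp only [Function.comp_apply]
      push_cast
      rw [add_div, one_div, mul_comm u]
    have hk' : Tendsto (fun n : ℕ => ((n + (⌊(n : ℝ) * u⌋₊ + 1) : ℕ) : ℝ) / n) atTop
        (𝓝 (1 + u)) := by
      refine (hk.const_add 1).congr' ?_
      filter_upwards [hn.eventually_gt_atTop 0] with n h
      rw [Nat.cast_add n, add_div, div_self h.ne']
    have h := (tendsto_rescaled_coeff hL (d - 1) (by linarith) hk').mul
      (tendsto_rescaled_coeff hL (d - 1) hu hk)
    simp only [hb]
    rwa [mul_comm] at h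

/-- for `0 < d < 1/2`, `L` slowly varying and `a i = i^(d-1) L i` for `i ≥ 1`,
the series `∑_{i=1}^∞ a_{n+i} a_i` converges for every `n ≥ 1`, and
`(L n ^ 2 * n^(2d-1))⁻¹ ∑_{i=1}^∞ a_{n+i} a_i → ∫_0^∞ u^(d-1) (1+u)^(d-1) du = B(d, 1-2d)`. -/
theorem statement0 (d : ℝ) (hd0 : 0 < d) (hd2 : d < 1 / 2) (L : ℝ → ℝ)
    (hL : SlowlyVaryingAtTop L) (a : ℕ → ℝ)
    (ha : ∀ i : ℕ, 1 ≤ i → a i = (i : ℝ) ^ (d - 1) * L i) :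
    (∀ n : ℕ, 1 ≤ n → Summable fun i : ℕ => a (n + (i + 1)) * a (i + 1)) ∧
    (∫ u in Set.Ioi (0 : ℝ), u ^ (d - 1) * (1 + u) ^ (d - 1)) =
      Real.Gamma d * Real.Gamma (1 - 2 * d) / Real.Gamma (1 - d) ∧
    Tendsto
      (fun n : ℕ =>
        (1 / (L n ^ 2 * (n : ℝ) ^ (2 * d - 1))) * ∑' i : ℕ, a (n + (i + 1)) * a (i + 1))
      atTop
      (𝓝 (∫ u in Set.Ioi (0 : ℝ), u ^ (d - 1) * (1 + u) ^ (d - 1))) := by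
  refine ⟨fun n _ => summable_shifted_mul_self hL hd2 ha n,
    integral_Ioi_rpow_mul_one_add_rpow hd0 hd2, ?_⟩
  refine (tendsto_integral_rescaled_coeff hL hd0 hd2
    (b := fun n i => ((i : ℝ) / n) ^ (d - 1) * (L i / L n)) fun _ _ => rfl).congr' ?_
  have hn : Tendsto (fun n : ℕ => (n : ℝ)) atTop atTop := tendsto_natCast_atTop_atTop
  filter_upwards [hn.eventually_gt_atTop 0, hn.eventually hL.2.1] with n n0 Ln0
  have hcoeff : ∀ i : ℕ, 1 ≤ i →
      ((i : ℝ) / n) ^ (d - 1) * (L i / L n) = (L n * (n : ℝ) ^ (d - 1))⁻¹ * a i := by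
    intro i hi
    rw [ha i hi, Real.div_rpow i.cast_nonneg n0.le]
    field_simp
  have hpow : (n : ℝ) ^ (2 * d - 1) = n * ((n : ℝ) ^ (d - 1)) ^ 2 := by
    rw [← Real.rpow_natCast, ← Real.rpow_mul n0.le, ← Real.rpow_one_add' n0.le]
    · congr 1
      push_cast
      ring
    · push_cast
      linarith
  have hterm : ∀ i : ℕ,
      (((n + (i + 1) : ℕ) : ℝ) / n) ^ (d - 1) * (L (n + (i + 1) : ℕ) / L n) *
        ((((i + 1 : ℕ) : ℝ) / n) ^ (d - 1) * (L (i + 1 : ℕ) / L n)) =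
      ((L n * (n : ℝ) ^ (d - 1)) ^ 2)⁻¹ * (a (n + (i + 1)) * a (i + 1)) := by
    intro i
    rw [hcoeff _ (by omega), hcoeff _ (by omega)]
    ring
  simp only [hterm]
  rw [integral_Ioi_comp_natFloor_mul
    (f := fun i => ((L n * (n : ℝ) ^ (d - 1)) ^ 2)⁻¹ * (a (n + (i + 1)) * a (i + 1)))
    ((summable_shifted_mul_self hL hd2 ha n).mul_left _) n0, tsum_mul_left, ← mul_assoc, hpow]
  congr 1
  field_simp
end

section
/- Let k ≥ 2 be an integer, 0 < d < 1/2, L slowly varying at infinity, and a_i = i^{d-1} L(i) for i ≥ 1 (a_i = 0 for i ≤ 0). Let γ(n) = ∑_{1 ≤ i_1 < ⋯ < i_k < ∞} a_{n+i_1} a_{i_1} ⋯ a_{n+i_k} a_{i_k}. Then the off-diagonal multiple sum is asymptotically equivalent to (1/k!) times the k-th power of the single sum: γ(n) / (∑_{i=1}^∞ a_{n+i} a_i)^k → 1/k! as n → ∞; that is, the diagonal terms with repeated indices are asymptotically negligible. -/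
open Filter Topology

/-- Strictly increasing `k`-tuples of positive natural numbers `1 ≤ i_1 < ⋯ < i_k`. -/
def IncrTuple (k : ℕ) : Type := {f : Fin k → ℕ // StrictMono f ∧ ∀ j, 0 < f j}

open MeasureTheory in
/-- Along a sequence tending to infinity, small increments hold simultaneously for all late
indices, outside a set of shifts of small measure. -/
theorem eventually_lt_volume_small_increments {h : ℝ → ℝ}
    (hh : ∀ u, Tendsto (fun x => h (x + u) - h x) atTop (𝓝 0)) {ε : ℝ} (hε : 0 < ε)
    {y : ℕ → ℝ} (hy : Tendsto y atTop atTop) :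
    ∀ᶠ n in atTop, ENNReal.ofReal (3 / 2) <
      volume {v ∈ Set.Icc (0 : ℝ) 2 | ∀ m ≥ n, |h (y m + v) - h (y m)| ≤ ε} := by
  set V : ℕ → Set ℝ := fun n => {v ∈ Set.Icc (0 : ℝ) 2 | ∀ m ≥ n, |h (y m + v) - h (y m)| ≤ ε}
  have hmono : Monotone V := fun n n' hn v hv => ⟨hv.1, fun m hm' => hv.2 m (hn.trans hm')⟩
  have hU : ⋃ n, V n = Set.Icc 0 2 := by
    refine Set.Subset.antisymm (Set.iUnion_subset fun n v hv => hv.1) fun v hv => ?_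
    have h1 := (hh v).comp hy
    have h2 := h1.eventually (Metric.closedBall_mem_nhds 0 hε)
    obtain ⟨n, hn⟩ := eventually_atTop.1 h2
    refine Set.mem_iUnion.2 ⟨n, hv, fun m hm' => ?_⟩
    simpa [Real.dist_eq] using hn m hm'
  have ht := tendsto_measure_iUnion_atTop (μ := volume) hmono
  rw [hU, Real.volume_Icc] at ht
  exact ht.eventually_const_lt (by rw [ENNReal.ofReal_lt_ofReal_iff] <;> norm_num)

theorem measurableSet_small_increments {h : ℝ → ℝ} (hm : Measurable h) (ε : ℝ) (y : ℕ → ℝ)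
    (n : ℕ) :
    MeasurableSet {v ∈ Set.Icc (0 : ℝ) 2 | ∀ m ≥ n, |h (y m + v) - h (y m)| ≤ ε} := by
  refine measurableSet_Icc.inter (s₂ := {v | ∀ m ≥ n, |h (y m + v) - h (y m)| ≤ ε}) ?_
  simp only [Set.ofPred_forall]
  refine MeasurableSet.iInter fun m => MeasurableSet.iInter fun _ => ?_
  refine measurableSet_le ?_ measurable_const
  exact ((hm.comp (measurable_const.add measurable_id)).sub measurable_const).abs

open MeasureTheory in
/-- Uniform convergence theorem for slowly varying functions, in additive form. -/
theorem uniform_small_increments {h : ℝ → ℝ} (hm : Measurable h)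
    (hh : ∀ u, Tendsto (fun x => h (x + u) - h x) atTop (𝓝 0)) {ε : ℝ} (hε : 0 < ε) :
    ∃ X, ∀ x ≥ X, ∀ u ∈ Set.Icc (0 : ℝ) 1, |h (x + u) - h x| ≤ ε := by
  by_contra! hcon
  choose x hx u hu hxu using fun n : ℕ => hcon n
  have hxt : Tendsto x atTop atTop := tendsto_atTop_mono hx tendsto_natCast_atTop_atTop
  have hxut : Tendsto (fun n => x n + u n) atTop atTop :=
    tendsto_atTop_mono (fun n => le_add_of_nonneg_right (hu n).1) hxt
  obtain ⟨n, hV, hW⟩ := ((eventually_lt_volume_small_increments hh (half_pos hε) hxt).and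
    (eventually_lt_volume_small_increments hh (half_pos hε) hxut)).exists
  set V := {v ∈ Set.Icc (0 : ℝ) 2 | ∀ m ≥ n, |h (x m + v) - h (x m)| ≤ ε / 2}
  set W := {v ∈ Set.Icc (0 : ℝ) 2 |
    ∀ m ≥ n, |h (x m + u m + v) - h (x m + u m)| ≤ ε / 2}
  rw [← measure_preimage_add_right volume (-u n) W] at hW
  have hWm : MeasurableSet ((fun v => v + -u n) ⁻¹' W) :=
    (measurable_id.add_const (-u n))
      (measurableSet_small_increments hm (ε / 2) (fun m => x m + u m) n)
  obtain ⟨v, hv, hw⟩ : (V ∩ (fun v => v + -u n) ⁻¹' W).Nonempty := by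
    refine nonempty_inter_of_measure_lt_add volume hWm (u := Set.Icc 0 3) ?_ ?_ ?_
    · exact fun v hv => ⟨hv.1.1, by linarith [hv.1.2]⟩
    · intro v hv
      have h1 := hv.1.1
      have h2 := hv.1.2
      exact ⟨by linarith [(hu n).1], by linarith [(hu n).2]⟩
    · calc volume (Set.Icc (0 : ℝ) 3) = ENNReal.ofReal (3 / 2) + ENNReal.ofReal (3 / 2) := by
            rw [Real.volume_Icc, ← ENNReal.ofReal_add] <;> norm_num
        _ < _ := ENNReal.add_lt_add hV hW
  have h1 := abs_le.1 (hv.2 n le_rfl)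
  have h2 := abs_le.1 (hw.2 n le_rfl)
  rw [show x n + u n + (v + -u n) = x n + v by ring] at h2
  refine (hxu n).not_ge (abs_le.2 ⟨by linarith, by linarith⟩)

theorem abs_increment_le {h : ℝ → ℝ} {ε X : ℝ}
    (hX : ∀ x ≥ X, ∀ u ∈ Set.Icc (0 : ℝ) 1, |h (x + u) - h x| ≤ ε) {x t : ℝ} (hx : X ≤ x)
    (ht : 0 ≤ t) : |h (x + t) - h x| ≤ ε * (1 + t) := by
  have hε : 0 ≤ ε := (abs_nonneg _).trans (hX X le_rfl 0 (by simp))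
  have key : ∀ n : ℕ, ∀ s : ℝ, 0 ≤ s → s ≤ 1 → |h (x + (s + n)) - h x| ≤ ε * (1 + n) := by
    intro n
    induction n with
    | zero => intro s hs hs1; simpa using hX x hx s ⟨hs, hs1⟩
    | succ n ih =>
      intro s hs hs1
      have h1 := ih s hs hs1
      have hn : (0 : ℝ) ≤ n := n.cast_nonneg
      have h2 := hX (x + (s + n)) (by linarith) 1 (by simp)
      rw [show x + (s + n) + 1 = x + (s + (n + 1 : ℕ)) by push_cast; ring] at h2
      have h3 := abs_sub_le (h (x + (s + (n + 1 : ℕ)))) (h (x + (s + n))) (h x)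
      push_cast at *
      linarith
  have h1 := key ⌊t⌋₊ (t - ⌊t⌋₊) (by linarith [Nat.floor_le ht])
    (by linarith [Nat.lt_floor_add_one t])
  rw [sub_add_cancel] at h1
  refine h1.trans (mul_le_mul_of_nonneg_left ?_ hε)
  linarith [Nat.floor_le ht]

/-- Potter's bounds. -/
theorem SlowlyVaryingAtTop.potter {L : ℝ → ℝ} (hL : SlowlyVaryingAtTop L) {ε : ℝ} (hε : 0 < ε) :
    ∃ X > 0, ∀ x ≥ X, 0 < L x ∧
      ∀ y ≥ x, |Real.log (L y) - Real.log (L x)| ≤ ε * (1 + Real.log (y / x)) := by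
  obtain ⟨hm, hpos, hlim⟩ := hL
  obtain ⟨X₀, hX₀⟩ := eventually_atTop.1 hpos
  have hh : ∀ u, Tendsto (fun x => Real.log (L (Real.exp (x + u))) - Real.log (L (Real.exp x)))
      atTop (𝓝 0) := by
    intro u
    have h1 := ((hlim (Real.exp u) (Real.exp_pos u)).comp Real.tendsto_exp_atTop).log one_ne_zero
    rw [Real.log_one] at h1
    refine h1.congr' ?_
    have h2 := Real.tendsto_exp_atTop.eventually hpos
    filter_upwards [h2, (tendsto_atTop_add_const_right _ u tendsto_id).eventually h2] with x hx hx'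
    simp only [id, Function.comp] at *
    rw [mul_comm, ← Real.exp_add, Real.log_div hx'.ne' hx.ne']
  obtain ⟨X₁, hX₁⟩ := uniform_small_increments (h := fun x => Real.log (L (Real.exp x)))
    (Real.measurable_log.comp (hm.comp Real.measurable_exp)) hh hε
  refine ⟨max X₀ (Real.exp X₁), by positivity, fun x hx => ⟨hX₀ x (le_of_max_le_left hx), ?_⟩⟩
  intro y hy
  have hx1 := le_of_max_le_right hx
  have hx0 : 0 < x := (Real.exp_pos _).trans_le hx1
  have hy0 : 0 < y := hx0.trans_le hy
  have := abs_increment_le (h := fun x => Real.log (L (Real.exp x))) hX₁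
    (x := Real.log x) (t := Real.log (y / x))
    ((Real.le_log_iff_exp_le hx0).2 hx1) (Real.log_nonneg ((one_le_div hx0).2 hy))
  beta_reduce at this
  rwa [← Real.log_mul hx0.ne' (by positivity), mul_div_cancel₀ _ hx0.ne', Real.exp_log hx0,
    Real.exp_log hy0] at this

open scoped ENNReal

theorem ENNReal.tsum_pi_prod (β : ℕ → ℝ≥0∞) (k : ℕ) :
    ∑' f : Fin k → ℕ, ∏ j, β (f j) = (∑' i, β i) ^ k := by
  induction k with
  | zero => simp
  | succ k ih =>
    rw [← (Fin.consEquiv fun _ : Fin (k + 1) => ℕ).tsum_eq, ENNReal.tsum_prod']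
    simp [Fin.consEquiv, Fin.prod_univ_succ, ENNReal.tsum_mul_left, ENNReal.tsum_mul_right, ih,
      pow_succ']

open Classical in
/-- The tuples with a repeated index contribute little to the `(k+1)`-st power of a sum. -/
theorem ENNReal.tsum_not_injective_le {β : ℕ → ℝ≥0∞} {M : ℝ≥0∞} (hM : ∀ i, β i ≤ M) (k : ℕ) :
    ∑' f : Fin (k + 1) → ℕ, (if f.Injective then 0 else ∏ j, β (f j)) ≤
      ((k + 1 : ℕ) : ℝ≥0∞) ^ 2 * M * (∑' i, β i) ^ k := by
  induction k with
  | zero =>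
    have : ∀ f : Fin 1 → ℕ, f.Injective := fun f => Function.injective_of_subsingleton f
    simp [this]
  | succ k ih =>
    set T := ∑' i, β i
    rw [← (Fin.consEquiv fun _ : Fin (k + 2) => ℕ).tsum_eq, ENNReal.tsum_prod']
    have hle : ∀ (x : ℕ) (g : Fin (k + 1) → ℕ),
        (if Function.Injective (Fin.cons x g : Fin (k + 2) → ℕ) then 0
          else ∏ j, β ((Fin.cons x g : Fin (k + 2) → ℕ) j)) ≤
        β x * (if g.Injective then 0 else ∏ j, β (g j)) +
          ∑ j, (if x = g j then M * ∏ j, β (g j) else 0) := by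
      intro x g
      rw [Fin.prod_univ_succ]
      simp only [Fin.cons_zero, Fin.cons_succ]
      by_cases hg : g.Injective
      · by_cases hx : x ∈ Set.range g
        · obtain ⟨i, rfl⟩ := hx
          refine le_trans ?_ le_add_self
          refine le_trans ?_ (Finset.single_le_sum (fun _ _ => zero_le) (Finset.mem_univ i))
          rw [if_pos rfl]
          split_ifs
          · exact zero_le
          · gcongr
            exact hM _
        · rw [if_pos (Fin.cons_injective_iff.2 ⟨hx, hg⟩)]
          exact zero_le
      · rw [if_neg hg]
        refine le_trans ?_ le_self_add
        split_ifs
        · exact zero_le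
        · exact le_rfl
    calc _ ≤ ∑' (x : ℕ) (g : Fin (k + 1) → ℕ),
          (β x * (if g.Injective then 0 else ∏ j, β (g j)) +
          ∑ j, (if x = g j then M * ∏ j, β (g j) else 0)) :=
          ENNReal.tsum_le_tsum fun x => ENNReal.tsum_le_tsum fun g => hle x g
      _ = T * ∑' g : Fin (k + 1) → ℕ, (if g.Injective then 0 else ∏ j, β (g j)) +
          ((k + 1 : ℕ) : ℝ≥0∞) * M * T ^ (k + 1) := by
        simp_rw [ENNReal.tsum_add]
        congr 1
        · simp_rw [ENNReal.tsum_mul_left, ENNReal.tsum_mul_right]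
          rfl
        · rw [ENNReal.tsum_comm]
          have : ∀ g : Fin (k + 1) → ℕ,
              ∑' x, ∑ j, (if x = g j then M * ∏ j, β (g j) else 0) =
                ((k + 1 : ℕ) : ℝ≥0∞) * M * ∏ j, β (g j) := by
            intro g
            rw [Summable.tsum_finsetSum fun _ _ => ENNReal.summable]
            simp [tsum_ite_eq, mul_assoc]
          simp_rw [this]
          rw [ENNReal.tsum_mul_left, ENNReal.tsum_pi_prod]
      _ ≤ T * (((k + 1 : ℕ) : ℝ≥0∞) ^ 2 * M * T ^ k) +
          ((k + 1 : ℕ) : ℝ≥0∞) * M * T ^ (k + 1) := by gcongr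
      _ = (((k + 1 : ℕ) : ℝ≥0∞) ^ 2 + ((k + 1 : ℕ) : ℝ≥0∞)) * (M * T ^ (k + 1)) := by ring
      _ ≤ ((k + 1 + 1 : ℕ) : ℝ≥0∞) ^ 2 * (M * T ^ (k + 1)) := by
        gcongr
        norm_cast
        nlinarith
      _ = _ := by ring

theorem summable_and_tsum_pi_prod {b : ℕ → ℝ} (hb : Summable b) (k : ℕ) :
    Summable (fun f : Fin k → ℕ => ∏ j, b (f j)) ∧
      ∑' f : Fin k → ℕ, ∏ j, b (f j) = (∑' i, b i) ^ k := by
  induction k with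
  | zero => exact ⟨(hasSum_fintype _).summable, by simp⟩
  | succ k ih =>
    have he : ∀ p : ℕ × (Fin k → ℕ),
        ∏ j, b ((Fin.consEquiv fun _ : Fin (k + 1) => ℕ) p j) = b p.1 * ∏ j, b (p.2 j) := by
      intro p
      simp [Fin.consEquiv, Fin.prod_univ_succ]
    constructor
    · rw [← (Fin.consEquiv fun _ : Fin (k + 1) => ℕ).summable_iff]
      simp only [Function.comp_def, he]
      exact summable_mul_of_summable_norm (f := b) (g := fun f : Fin k → ℕ => ∏ j, b (f j))
        hb.norm ih.1.norm
    · rw [← (Fin.consEquiv fun _ : Fin (k + 1) => ℕ).tsum_eq]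
      simp only [he]
      rw [pow_succ', ← ih.2, tsum_mul_tsum_of_summable_norm (f := b)
        (g := fun f : Fin k → ℕ => ∏ j, b (f j)) hb.norm ih.1.norm]

/-- Injective tuples are permuted strictly increasing ones. -/
noncomputable def permIncrTupleEquiv (k : ℕ) :
    Equiv.Perm (Fin k) × IncrTuple k ≃ {f : Fin k → ℕ // f.Injective} :=
  Equiv.ofBijective
    (fun p => ⟨fun j => p.2.1 (p.1 j) - 1, fun j j' h => p.1.injective <| p.2.2.1.injective <| by
      have h1 := p.2.2.2 (p.1 j)
      have h2 := p.2.2.2 (p.1 j')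
      simp only at h
      omega⟩) <| by
    constructor
    · rintro ⟨σ, f, hf, hf0⟩ ⟨τ, g, hg, hg0⟩ h
      have h1 : f ∘ σ = g ∘ τ := by
        funext j
        have h2 := congrFun (congrArg Subtype.val h) j
        have h3 := hf0 (σ j)
        have h4 := hg0 (τ j)
        simp only at h2
        simp only [Function.comp]
        omega
      have h2 : f = g := by
        refine (hf.range_inj hg).1 ?_
        rw [← σ.surjective.range_comp f, h1, τ.surjective.range_comp g]
      subst h2
      have h3 : σ = τ := Equiv.ext fun j => hf.injective (congrFun h1 j)
      subst h3
      rfl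
    · rintro ⟨f, hf⟩
      have hs : StrictMono (f ∘ Tuple.sort f) :=
        (Tuple.monotone_sort f).strictMono_of_injective (hf.comp (Tuple.sort f).injective)
      refine ⟨((Tuple.sort f)⁻¹, ⟨fun j => f (Tuple.sort f j) + 1,
        fun i j hij => Nat.succ_lt_succ (hs hij), fun j => Nat.succ_pos _⟩), ?_⟩
      ext j
      simp

theorem tsum_injective_eq {b : ℕ → ℝ} (hb : Summable b) (k : ℕ) :
    ∑' f : {f : Fin k → ℕ // f.Injective}, ∏ j, b (f.1 j) =
      k.factorial * ∑' i : IncrTuple k, ∏ j, b (i.1 j - 1) := by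
  have hs : Summable fun f : {f : Fin k → ℕ // f.Injective} => ∏ j, b (f.1 j) :=
    (summable_and_tsum_pi_prod hb k).1.subtype _
  have he : ∀ p : Equiv.Perm (Fin k) × IncrTuple k,
      ∏ j, b ((permIncrTupleEquiv k p).1 j) = ∏ j, b (p.2.1 j - 1) := fun p =>
    Equiv.prod_comp p.1 fun j => b (p.2.1 j - 1)
  rw [← (permIncrTupleEquiv k).summable_iff] at hs
  rw [← (permIncrTupleEquiv k).tsum_eq]
  simp only [Function.comp_def, he] at hs ⊢
  rw [hs.tsum_prod]
  simp [Fintype.card_perm]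

open Classical in
theorem abs_factorial_mul_tsum_sub_pow_le {b : ℕ → ℝ} (hb : Summable b) {M : ℝ}
    (hM : ∀ i, |b i| ≤ M) (k : ℕ) :
    |(k + 1).factorial * ∑' i : IncrTuple (k + 1), ∏ j, b (i.1 j - 1) - (∑' i, b i) ^ (k + 1)| ≤
      ((k + 1 : ℕ) : ℝ) ^ 2 * M * (∑' i, |b i|) ^ k := by
  have hM0 : 0 ≤ M := (abs_nonneg _).trans (hM 0)
  obtain ⟨hs, hsum⟩ := summable_and_tsum_pi_prod hb (k + 1)
  obtain ⟨hsa, -⟩ := summable_and_tsum_pi_prod hb.abs (k + 1)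
  set F : (Fin (k + 1) → ℕ) → ℝ := fun f => if f.Injective then 0 else ∏ j, b (f j) with hF
  have hFa : ∀ f, ENNReal.ofReal |F f| =
      if f.Injective then 0 else ∏ j, ENNReal.ofReal |b (f j)| := by
    intro f
    simp only [hF]
    split_ifs
    · simp
    · rw [Finset.abs_prod, ENNReal.ofReal_prod_of_nonneg fun _ _ => abs_nonneg _]
  have hFs : Summable fun f => |F f| := by
    refine hsa.of_nonneg_of_le (fun _ => abs_nonneg _) fun f => ?_
    simp only [hF]
    split_ifs
    · simpa using Finset.prod_nonneg fun j _ => abs_nonneg (b (f j))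
    · rw [Finset.abs_prod]
  have hle := ENNReal.tsum_not_injective_le (β := fun i => ENNReal.ofReal |b i|)
    (M := ENNReal.ofReal M) (fun i => ENNReal.ofReal_le_ofReal (hM i)) k
  simp_rw [← hFa] at hle
  rw [← ENNReal.ofReal_tsum_of_nonneg (fun _ => abs_nonneg _) hFs,
    ← ENNReal.ofReal_tsum_of_nonneg (fun _ => abs_nonneg _) hb.abs,
    ← ENNReal.ofReal_pow (tsum_nonneg fun _ => abs_nonneg _), ← ENNReal.ofReal_natCast,
    ← ENNReal.ofReal_pow (Nat.cast_nonneg _), ← ENNReal.ofReal_mul (by positivity),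
    ← ENNReal.ofReal_mul (by positivity), ENNReal.ofReal_le_ofReal_iff (mul_nonneg (by positivity)
      (pow_nonneg (tsum_nonneg fun _ => abs_nonneg _) _))] at hle
  refine le_trans ?_ hle
  have hsplit : (k + 1).factorial * ∑' i : IncrTuple (k + 1), ∏ j, b (i.1 j - 1) -
      (∑' i, b i) ^ (k + 1) = - ∑' f, F f := by
    have hi := tsum_subtype {f : Fin (k + 1) → ℕ | f.Injective} fun f => ∏ j, b (f j)
    have hind : Summable ({f : Fin (k + 1) → ℕ | f.Injective}.indicator fun f => ∏ j, b (f j)) :=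
      hs.indicator _
    rw [← tsum_injective_eq hb, ← hsum]
    refine (congrArg (· - _) hi).trans ?_
    rw [← hind.tsum_sub hs, ← tsum_neg]
    refine tsum_congr fun f => ?_
    by_cases hf : f.Injective <;> simp [hF, hf, Set.indicator]
  rw [hsplit, abs_neg]
  have := norm_tsum_le_tsum_norm (f := F) hFs
  simpa [Real.norm_eq_abs] using this

/-- Potter's bounds for a regularly varying sequence of index `d - 1`. -/
theorem SlowlyVaryingAtTop.potter_seq {L : ℝ → ℝ} (hL : SlowlyVaryingAtTop L) {a : ℕ → ℝ} {d : ℝ}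
    (ha : ∀ i : ℕ, 1 ≤ i → a i = (i : ℝ) ^ (d - 1) * L i) {ε : ℝ} (hε : 0 < ε) :
    ∃ N ≥ 1, ∀ i ≥ N, 0 < a i ∧ ∀ j ≥ i,
      Real.exp (-ε) * ((j : ℝ) / i) ^ (d - 1 - ε) * a i ≤ a j ∧
      a j ≤ Real.exp ε * ((j : ℝ) / i) ^ (d - 1 + ε) * a i := by
  obtain ⟨X, hX0, hX⟩ := hL.potter hε
  refine ⟨max 1 ⌈X⌉₊, le_max_left _ _, fun i hi => ?_⟩
  have hi1 : 1 ≤ i := le_of_max_le_left hi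
  have hiX : ∀ j ≥ i, X ≤ (j : ℝ) := fun j hj =>
    Nat.ceil_le.1 ((le_of_max_le_right hi).trans hj)
  have hpos : ∀ j ≥ i, 0 < a j := fun j hj => by
    have hj0 : (0 : ℝ) < j := hX0.trans_le (hiX j hj)
    rw [ha j (hi1.trans hj)]
    exact mul_pos (Real.rpow_pos_of_pos hj0 _) (hX j (hiX j hj)).1
  have hlog : ∀ j ≥ i, Real.log (a j) = (d - 1) * Real.log j + Real.log (L j) := fun j hj => by
    have hj0 : (0 : ℝ) < j := hX0.trans_le (hiX j hj)
    rw [ha j (hi1.trans hj), Real.log_mul (Real.rpow_pos_of_pos hj0 _).ne'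
      (hX j (hiX j hj)).1.ne', Real.log_rpow hj0]
  refine ⟨hpos i le_rfl, fun j hj => ?_⟩
  have hi0 : (0 : ℝ) < i := hX0.trans_le (hiX i le_rfl)
  have hj0 : (0 : ℝ) < j := hX0.trans_le (hiX j hj)
  have hai := hpos i le_rfl
  have haj := hpos j hj
  have hq : (0 : ℝ) < (j : ℝ) / i := div_pos hj0 hi0
  have hb := abs_le.1 ((hX i (hiX i le_rfl)).2 j (Nat.cast_le.2 hj))
  have hlj := hlog j hj
  have hli := hlog i le_rfl
  have hdiv : Real.log ((j : ℝ) / i) = Real.log j - Real.log i := Real.log_div hj0.ne' hi0.ne'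
  have hmul : ∀ e s : ℝ, Real.log (Real.exp e * ((j : ℝ) / i) ^ s * a i) =
      e + s * Real.log ((j : ℝ) / i) + Real.log (a i) := fun e s => by
    rw [Real.log_mul (by positivity) hai.ne', Real.log_mul (by positivity) (by positivity),
      Real.log_exp, Real.log_rpow hq]
  constructor
  · rw [← Real.log_le_log_iff (by positivity) haj, hmul, hlj, hli]
    rw [hdiv] at hb ⊢
    linarith [hb.1]
  · rw [← Real.log_le_log_iff haj (by positivity), hmul, hlj, hli]
    rw [hdiv] at hb ⊢
    linarith [hb.2]

section Autocorrelation

variable {a : ℕ → ℝ} {N : ℕ}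

theorem summable_autocorrelation (hsq : Summable fun i => a i ^ 2) (n : ℕ) :
    Summable fun i => a (n + (i + 1)) * a (i + 1) := by
  have h1 : Summable fun i => a (i + 1) ^ 2 := (summable_nat_add_iff 1).2 hsq
  have h2 : Summable fun i => a (n + (i + 1)) ^ 2 := by
    simpa only [show ∀ i, i + (n + 1) = n + (i + 1) by intro i; omega] using
      (summable_nat_add_iff (n + 1)).2 hsq
  refine (h1.add h2).of_norm_bounded fun i => ?_
  rw [Real.norm_eq_abs, abs_le]
  constructor <;> nlinarith [sq_nonneg (a (n + (i + 1)) + a (i + 1)),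
    sq_nonneg (a (n + (i + 1)) - a (i + 1)), sq_nonneg (a (n + (i + 1))), sq_nonneg (a (i + 1))]

theorem tsum_abs_autocorrelation_le (hpos : ∀ i ≥ N, 0 < a i) (hsq : Summable fun i => a i ^ 2)
    {n : ℕ} {M : ℝ} (hM : ∀ i, |a (n + (i + 1)) * a (i + 1)| ≤ M) :
    ∑' i, |a (n + (i + 1)) * a (i + 1)| ≤
      ∑' i, a (n + (i + 1)) * a (i + 1) + 2 * N * M := by
  have hs := summable_autocorrelation hsq n
  rw [← sub_le_iff_le_add', ← hs.abs.tsum_sub hs, tsum_eq_sum (s := Finset.range N)]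
  · refine (Finset.sum_le_card_nsmul _ _ (2 * M) fun i _ => ?_).trans_eq ?_
    · have := hM i
      have := abs_le.1 this
      linarith
    · simp; ring
  · intro i hi
    have hi : N ≤ i := by simpa using hi
    rw [abs_of_pos (mul_pos (hpos _ (by omega)) (hpos _ (by omega))), sub_self]

theorem mul_sum_le_tsum_abs_autocorrelation (hpos : ∀ i ≥ N, 0 < a i)
    (hsq : Summable fun i => a i ^ 2) {c : ℝ} (hc : ∀ n ≥ N, ∀ i ≤ n, c * a n ≤ a (n + i))
    {n : ℕ} (hn : N ≤ n) :
    c * a n * ∑ i ∈ Finset.range n, (if i < N then 0 else a (i + 1)) ≤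
      ∑' i, |a (n + (i + 1)) * a (i + 1)| := by
  refine le_trans ?_
    ((summable_autocorrelation hsq n).abs.sum_le_tsum (Finset.range n) fun _ _ => abs_nonneg _)
  rw [Finset.mul_sum]
  refine Finset.sum_le_sum fun i hi => ?_
  have hi : i < n := Finset.mem_range.1 hi
  split_ifs with h
  · rw [mul_zero]
    exact abs_nonneg _
  · refine le_trans ?_ (le_abs_self _)
    exact mul_le_mul_of_nonneg_right (hc n hn _ hi) (hpos _ (by omega)).le

/-- The largest term of the autocorrelation sum is negligible compared with the sum. -/
theorem exists_autocorrelation_bound (hpos : ∀ i ≥ N, 0 < a i)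
    (hsq : Summable fun i => a i ^ 2)
    {C : ℝ} (hC : ∀ i ≥ N, ∀ j ≥ i, a j ≤ C * a i)
    {c : ℝ} (hc0 : 0 < c) (hc : ∀ n ≥ N, ∀ i ≤ n, c * a n ≤ a (n + i))
    (hdiv : Tendsto (fun n => ∑ i ∈ Finset.range n, (if i < N then 0 else a (i + 1)))
      atTop atTop) :
    ∃ M : ℕ → ℝ, (∀ n ≥ N, ∀ i, |a (n + (i + 1)) * a (i + 1)| ≤ M n) ∧
      (∀ᶠ n in atTop, 0 < ∑' i, a (n + (i + 1)) * a (i + 1)) ∧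
      Tendsto (fun n => M n / ∑' i, a (n + (i + 1)) * a (i + 1)) atTop (𝓝 0) := by
  set B := √(∑' i, a i ^ 2)
  have hB : ∀ i, |a i| ≤ B := fun i =>
    Real.abs_le_sqrt (hsq.le_tsum i fun _ _ => sq_nonneg _)
  have hM : ∀ n ≥ N, ∀ i, |a (n + (i + 1)) * a (i + 1)| ≤ C * B * a n := by
    intro n hn i
    rw [abs_mul, abs_of_pos (hpos _ (by omega)), mul_right_comm]
    exact mul_le_mul (hC n hn _ (by omega)) (hB _) (abs_nonneg _)
      ((hpos _ (by omega)).le.trans (hC n hn n le_rfl))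
  set A : ℕ → ℝ := fun n => c * ∑ i ∈ Finset.range n, (if i < N then 0 else a (i + 1)) -
    2 * N * (C * B) with hA
  have hAt : Tendsto A atTop atTop :=
    tendsto_atTop_add_const_right _ _ (hdiv.const_mul_atTop hc0)
  have hS : ∀ n ≥ N, a n * A n ≤ ∑' i, a (n + (i + 1)) * a (i + 1) := by
    intro n hn
    have h1 := mul_sum_le_tsum_abs_autocorrelation hpos hsq hc hn
    have h2 := tsum_abs_autocorrelation_le hpos hsq (hM n hn)
    calc a n * A n = c * a n * ∑ i ∈ Finset.range n, (if i < N then 0 else a (i + 1)) -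
        2 * N * (C * B * a n) := by simp only [hA]; ring
      _ ≤ _ := by linarith
  have hev : ∀ᶠ n in atTop, N ≤ n ∧ 0 < A n :=
    (eventually_ge_atTop N).and (hAt.eventually_gt_atTop 0)
  have hSpos : ∀ᶠ n in atTop, 0 < ∑' i, a (n + (i + 1)) * a (i + 1) :=
    hev.mono fun n hn => (mul_pos (hpos n hn.1) hn.2).trans_le (hS n hn.1)
  refine ⟨fun n => C * B * a n, hM, hSpos, ?_⟩
  refine squeeze_zero' (g := fun n => C * B / A n) ?_ ?_ (hAt.const_div_atTop _)
  · filter_upwards [hSpos, hev] with n hn hn'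
    exact div_nonneg ((abs_nonneg _).trans (hM n hn'.1 0)) hn.le
  · filter_upwards [hSpos, hev] with n hn hn'
    have han := hpos n hn'.1
    have hCB : 0 ≤ C * B := nonneg_of_mul_nonneg_left ((abs_nonneg _).trans (hM n hn'.1 0)) han
    rw [div_le_div_iff₀ hn hn'.2, mul_assoc]
    exact mul_le_mul_of_nonneg_left (hS n hn'.1) hCB

end Autocorrelation

section PotterConsequences

variable {a : ℕ → ℝ} {N : ℕ}

theorem summable_sq_of_le_rpow (hN : 1 ≤ N) (hpos : ∀ i ≥ N, 0 < a i) {K p : ℝ} (hp : p < -(1 / 2))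
    (hK : ∀ j ≥ N, a j ≤ K * ((j : ℝ) / N) ^ p * a N) : Summable fun i => a i ^ 2 := by
  have hs : Summable fun j : ℕ => (K * (N : ℝ) ^ (-p) * a N) ^ 2 * (j : ℝ) ^ (2 * p) :=
    (Real.summable_nat_rpow.2 (by linarith)).mul_left _
  refine hs.of_norm_bounded_eventually_nat ?_
  filter_upwards [eventually_ge_atTop N] with j hj
  have hj0 : (0 : ℝ) < j := by exact_mod_cast hN.trans hj
  have hN0 : (0 : ℝ) < N := by exact_mod_cast hN
  rw [Real.norm_of_nonneg (sq_nonneg _)]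
  refine (pow_le_pow_left₀ (hpos j hj).le (hK j hj) 2).trans_eq ?_
  rw [Real.div_rpow hj0.le hN0.le, Real.rpow_neg hN0.le, mul_comm 2 p, Real.rpow_mul hj0.le,
    Real.rpow_two]
  ring

theorem tendsto_sum_of_rpow_le (hN : 1 ≤ N) (hpos : ∀ i ≥ N, 0 < a i) {K p : ℝ} (hK0 : 0 < K)
    (hp : -1 ≤ p) (hK : ∀ j ≥ N, K * ((j : ℝ) / N) ^ p * a N ≤ a j) :
    Tendsto (fun n => ∑ i ∈ Finset.range n, (if i < N then 0 else a (i + 1))) atTop atTop := by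
  rw [← not_summable_iff_tendsto_nat_atTop_of_nonneg]
  · intro hs
    refine mt Real.summable_nat_rpow.1 (not_lt.2 hp) ((summable_nat_add_iff 1).1 ?_)
    refine (hs.mul_left (K * (N : ℝ) ^ (-p) * a N)⁻¹).of_norm_bounded_eventually_nat ?_
    filter_upwards [eventually_ge_atTop N] with j hj
    have hN0 : (0 : ℝ) < N := by exact_mod_cast hN
    have haN := hpos N le_rfl
    rw [if_neg hj.not_gt, Real.norm_of_nonneg (by positivity), le_inv_mul_iff₀ (by positivity)]
    refine le_trans (le_of_eq ?_) (hK (j + 1) (by omega))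
    rw [Real.div_rpow (by positivity) hN0.le, Real.rpow_neg hN0.le]
    ring
  · intro i
    split_ifs
    · exact le_rfl
    · exact (hpos _ (by omega)).le

end PotterConsequences

/-- for `k ≥ 2`, `0 < d < 1/2`, `a i = i^{d-1} L i`, the off-diagonal multiple sum
`γ(n) = ∑_{1 ≤ i_1 < ⋯ < i_k} ∏_j a_{n+i_j} a_{i_j}` satisfies
`γ(n) / (∑_{i=1}^∞ a_{n+i} a_i)^k → 1/k!` as `n → ∞`. -/
theorem statement2 (k : ℕ) (hk : 2 ≤ k) (d : ℝ) (hd0 : 0 < d) (hd2 : d < 1 / 2)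
    (L : ℝ → ℝ) (hL : SlowlyVaryingAtTop L) (a : ℕ → ℝ)
    (ha : ∀ i : ℕ, 1 ≤ i → a i = (i : ℝ) ^ (d - 1) * L i)
    (γ : ℕ → ℝ)
    (hγ : ∀ n : ℕ, γ n = ∑' i : IncrTuple k, ∏ j, (a (n + i.1 j) * a (i.1 j))) :
    Tendsto (fun n : ℕ => γ n / (∑' i : ℕ, a (n + (i + 1)) * a (i + 1)) ^ k)
      atTop (𝓝 (1 / (k.factorial : ℝ))) := by
  obtain ⟨ε, hε0, hεd, hε2⟩ : ∃ ε > 0, ε ≤ d ∧ ε < 1 / 2 - d :=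
    ⟨min d ((1 / 2 - d) / 2), lt_min hd0 (by linarith), min_le_left _ _,
      (min_le_right _ _).trans_lt (by linarith)⟩
  obtain ⟨N, hN, hP⟩ := hL.potter_seq ha hε0
  have hpos : ∀ i ≥ N, 0 < a i := fun i hi => (hP i hi).1
  have hsq : Summable fun i => a i ^ 2 :=
    summable_sq_of_le_rpow hN hpos (p := d - 1 + ε) (by linarith)
      fun j hj => ((hP N le_rfl).2 j hj).2
  have hdiv := tendsto_sum_of_rpow_le hN hpos (p := d - 1 - ε) (Real.exp_pos (-ε)) (by linarith)
    fun j hj => ((hP N le_rfl).2 j hj).1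
  have hC : ∀ i ≥ N, ∀ j ≥ i, a j ≤ Real.exp ε * a i := fun i hi j hj => by
    have hi0 : (0 : ℝ) < i := by exact_mod_cast hN.trans hi
    have hij : 1 ≤ (j : ℝ) / i := (one_le_div hi0).2 (Nat.cast_le.2 hj)
    refine ((hP i hi).2 j hj).2.trans (mul_le_mul_of_nonneg_right ?_ (hpos i hi).le)
    exact mul_le_of_le_one_right (Real.exp_pos _).le
      (Real.rpow_le_one_of_one_le_of_nonpos hij (by linarith))
  have hc : ∀ n ≥ N, ∀ i ≤ n, Real.exp (-ε) * 2 ^ (d - 1 - ε) * a n ≤ a (n + i) :=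
    fun n hn i hi => by
    have hn0 : (0 : ℝ) < n := by exact_mod_cast hN.trans hn
    refine le_trans ?_ ((hP n hn).2 (n + i) (by omega)).1
    refine mul_le_mul_of_nonneg_right (mul_le_mul_of_nonneg_left ?_ (Real.exp_pos _).le)
      (hpos n hn).le
    refine Real.rpow_le_rpow_of_nonpos (div_pos (by push_cast; positivity) hn0) ?_ (by linarith)
    rw [div_le_iff₀ hn0]
    have : (i : ℝ) ≤ n := Nat.cast_le.2 hi
    push_cast
    linarith
  obtain ⟨M, hM, hS, hr⟩ := exists_autocorrelation_bound hpos hsq hC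
    (mul_pos (Real.exp_pos _) (Real.rpow_pos_of_pos two_pos _)) hc hdiv
  obtain ⟨m, rfl⟩ : ∃ m, k = m + 1 := ⟨k - 1, by omega⟩
  set S : ℕ → ℝ := fun n => ∑' i, a (n + (i + 1)) * a (i + 1)
  have hγ' : ∀ n, γ n = ∑' i : IncrTuple (m + 1),
      ∏ j, (a (n + (i.1 j - 1 + 1)) * a (i.1 j - 1 + 1)) := fun n => by
    rw [hγ]
    refine tsum_congr fun i => Finset.prod_congr rfl fun j _ => ?_
    rw [Nat.sub_add_cancel (i.2.2 j)]
  have hlim : Tendsto (fun n => (m + 1).factorial * γ n / S n ^ (m + 1)) atTop (𝓝 1) := by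
    rw [tendsto_iff_dist_tendsto_zero]
    refine squeeze_zero' (g := fun n => ((m + 1 : ℕ) : ℝ) ^ 2 * (M n / S n) *
      (1 + 2 * N * (M n / S n)) ^ m) (Eventually.of_forall fun _ => dist_nonneg) ?_ ?_
    · filter_upwards [hS, eventually_ge_atTop N] with n hSn hn
      have h1 := abs_factorial_mul_tsum_sub_pow_le (summable_autocorrelation hsq n) (hM n hn) m
      rw [← hγ'] at h1
      have hM0 : 0 ≤ M n := (abs_nonneg _).trans (hM n hn 0)
      have h2 := pow_le_pow_left₀ (tsum_nonneg fun _ => abs_nonneg _)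
        (tsum_abs_autocorrelation_le hpos hsq (hM n hn)) m
      have h3 := h1.trans (mul_le_mul_of_nonneg_left h2 (by positivity))
      change |_ - S n ^ (m + 1)| ≤ _ * (S n + _) ^ m at h3
      change 0 < S n at hSn
      rw [Real.dist_eq, div_sub_one (pow_pos hSn _).ne', abs_div, abs_of_pos (pow_pos hSn (m + 1)),
        div_le_iff₀ (pow_pos hSn _)]
      refine h3.trans_eq ?_
      rw [show S n + 2 * N * M n = (1 + 2 * N * (M n / S n)) * S n by field_simp, mul_pow, pow_succ]
      field_simp
      ring
    · have h1 := (hr.const_mul (((m + 1 : ℕ) : ℝ) ^ 2)).mul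
        (((hr.const_mul (2 * (N : ℝ))).const_add 1).pow m)
      simpa using h1
  refine ((hlim.const_mul (1 / ((m + 1).factorial : ℝ))).congr fun n => ?_).trans ?_
  · have : ((m + 1).factorial : ℝ) ≠ 0 := by positivity
    field_simp
    rfl
  · rw [mul_one]
end
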